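/- Let n be a positive integer and let A, B be real numbers with (1+B)_n ≠ 0 and 2A + B ≠ 0. Then ∑_{k=0}^{⌊n/2⌋} [ (1−2n/3)_k · (−n/2)_k · ((1−n)/2)_k · (−A)_k · (A+B)_k ] / [ k! · (−2n/3)_k · (1−n)_k · ((1+B)/2)_k · (1+B/2)_k ] = (1/2) · (A−B−2n)/(2A+B) · (−A)_n/(1+B)_n + (1/2) · (A+2B+2n)/(2A+B) · (A+B)_n/(1+B)_n. (Lemma A4, a terminating 5F4 summation) -/

import Mathlib

open Finset

/-- The Pochhammer symbol `(a)_k = a(a+1)⋯(a+k-1)` for a real `a`. -/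
noncomputable def poch (a : ℝ) (k : ℕ) : ℝ := ∏ i ∈ Finset.range k, (a + i)

theorem poch_zero (a : ℝ) : poch a 0 = 1 := by simp [poch]

theorem poch_succ (a : ℝ) (k : ℕ) : poch a (k + 1) = poch a k * (a + k) := by
  simp [poch, Finset.prod_range_succ]

theorem poch_add (a : ℝ) (m k : ℕ) : poch a (m + k) = poch a m * poch (a + m) k := by
  simp only [poch, Finset.prod_range_add]
  simp [add_assoc]

theorem poch_succ' (a : ℝ) (k : ℕ) : poch a (k + 1) = a * poch (a + 1) k := by
  rw [add_comm k 1, poch_add, poch_succ, poch_zero]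
  simp

theorem poch_ne_zero {a : ℝ} {k : ℕ} (h : ∀ i < k, a + i ≠ 0) : poch a k ≠ 0 :=
  Finset.prod_ne_zero_iff.2 fun i hi => h i (Finset.mem_range.1 hi)

theorem poch_two_mul (a : ℝ) (k : ℕ) :
    poch a (2 * k) = 4 ^ k * poch (a / 2) k * poch ((a + 1) / 2) k := by
  induction k with
  | zero => simp [poch_zero]
  | succ k ih =>
    rw [show 2 * (k + 1) = 2 * k + 1 + 1 by ring, poch_succ, poch_succ, ih, poch_succ, poch_succ]
    push_cast
    ring

theorem poch_neg_natCast (n k : ℕ) : poch (-(n : ℝ)) k = (-1) ^ k * n.descFactorial k := by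
  induction k with
  | zero => simp [poch_zero]
  | succ k ih =>
    rw [poch_succ, ih, Nat.descFactorial_succ]
    rcases le_or_gt k n with h | h
    · push_cast [Nat.cast_sub h]
      ring
    · simp [Nat.descFactorial_of_lt h]

/-- The summand of a rising-factorial analogue of
`∑ₖ (-1)ᵏ C(n-k, k) (xy)ᵏ (x+y)ⁿ⁻²ᵏ = (yⁿ⁺¹ - xⁿ⁺¹) / (y - x)`. -/
noncomputable def lucasTerm (x y : ℝ) (n k : ℕ) : ℝ :=
  ((n - k).choose k : ℝ) * (-1) ^ k * poch x k * poch y k * poch (1 + x + y + 2 * k) (n - 2 * k)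

theorem lucasTerm_eq_zero (x y : ℝ) {n k : ℕ} (h : n < 2 * k) : lucasTerm x y n k = 0 := by
  simp [lucasTerm, Nat.choose_eq_zero_of_lt (show n - k < k by omega)]

theorem choose_mul_poch_sub (z : ℝ) (n k : ℕ) (h : 2 * k ≤ n + 1) :
    ((n - k).choose k : ℝ) * poch (z + 2 * k) (n + 1 - 2 * k) =
      (z + n) * ((n - k).choose k * poch (z + 2 * k) (n - 2 * k)) := by
  rcases Nat.lt_or_ge n (2 * k) with h' | h'
  · simp [Nat.choose_eq_zero_of_lt (show n - k < k by omega)]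
  · obtain ⟨m, rfl⟩ := Nat.exists_eq_add_of_le h'
    rw [show 2 * k + m + 1 - 2 * k = m + 1 by omega, Nat.add_sub_cancel_left, poch_succ]
    push_cast
    ring

theorem lucasTerm_zero (x y : ℝ) (n : ℕ) :
    lucasTerm x y (n + 1) 0 = (1 + x + y + n) * lucasTerm x y n 0 := by
  simp [lucasTerm, poch_zero, poch_succ, mul_comm]

theorem lucasTerm_succ (x y : ℝ) (n k : ℕ) :
    lucasTerm x y (n + 2) (k + 1) =
      (x + y + n + 2) * lucasTerm x y (n + 1) (k + 1) -
        x * y * lucasTerm (x + 1) (y + 1) n k := by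
  rcases Nat.lt_or_ge n (2 * k) with h | h
  · rw [lucasTerm_eq_zero _ _ h, lucasTerm_eq_zero _ _ (by omega), lucasTerm_eq_zero _ _ (by omega)]
    ring
  · have key := choose_mul_poch_sub (1 + x + y) (n + 1) (k + 1) (by omega)
    simp only [lucasTerm, poch_succ' x, poch_succ' y]
    rw [show n + 1 + 1 - 2 * (k + 1) = n - 2 * k by omega,
      show n + 1 - (k + 1) = n - k by omega] at key
    rw [show n + 2 - (k + 1) = n - k + 1 by omega, Nat.choose_succ_succ,
      show n + 2 - 2 * (k + 1) = n - 2 * k by omega, show n + 1 - (k + 1) = n - k by omega,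
      show 1 + (x + 1) + (y + 1) + 2 * (k : ℝ) = 1 + x + y + 2 * (k + 1 : ℕ) by push_cast; ring]
    push_cast at key ⊢
    linear_combination (-1) ^ (k + 1) * x * poch (x + 1) k * y * poch (y + 1) k * key

theorem sum_lucasTerm_succ (x y : ℝ) (n N : ℕ) :
    ∑ k ∈ range (N + 1), lucasTerm x y (n + 2) k =
      (x + y + n + 2) * ∑ k ∈ range (N + 1), lucasTerm x y (n + 1) k -
        x * y * ∑ k ∈ range N, lucasTerm (x + 1) (y + 1) n k := by
  simp only [Finset.sum_range_succ' _ N, lucasTerm_succ, lucasTerm_zero x y (n + 1),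
    Finset.sum_sub_distrib, ← Finset.mul_sum]
  push_cast
  ring

theorem sub_mul_sum_lucasTerm (n : ℕ) : ∀ (x y : ℝ) (N : ℕ), n < 2 * N →
    (y - x) * ∑ k ∈ range N, lucasTerm x y n k = poch y (n + 1) - poch x (n + 1) := by
  induction n using Nat.twoStepInduction with
  | zero =>
    intro x y N hN
    rw [Finset.sum_eq_single_of_mem 0 (by simp; omega)
      fun k _ hk => lucasTerm_eq_zero _ _ (by omega)]
    simp [lucasTerm, poch_zero, poch_succ]
  | one =>
    intro x y N hN
    rw [Finset.sum_eq_single_of_mem 0 (by simp; omega)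
      fun k _ hk => lucasTerm_eq_zero _ _ (by omega)]
    simp [lucasTerm, poch_zero, poch_succ]
    ring
  | more n ih₀ ih₁ =>
    intro x y N hN
    obtain ⟨N, rfl⟩ : ∃ M, N = M + 1 := ⟨N - 1, by omega⟩
    have h₀ := ih₀ (x + 1) (y + 1) N (by omega)
    have h₁ := ih₁ x y (N + 1) (by omega)
    have hx := poch_succ' x (n + 1)
    have hy := poch_succ' y (n + 1)
    rw [sum_lucasTerm_succ, poch_succ y (n + 1 + 1), poch_succ x (n + 1 + 1)]
    push_cast at h₁ ⊢
    linear_combination (x + y + n + 2) * h₁ - x * y * h₀ + x * hy - y * hx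

theorem descFactorial_two_mul_mul (n k : ℕ) :
    (n + 1).descFactorial (2 * k) * (n + 1 - k) =
      (n + 1) * n.descFactorial k * k.factorial * (n + 1 - k).choose k := by
  have h₁ : (n + 1).descFactorial (2 * k) =
      (n + 1 - k).descFactorial k * (n + 1).descFactorial k := by
    rw [two_mul, ← Nat.descFactorial_mul_descFactorial (Nat.le_add_left k k), Nat.add_sub_cancel]
  have h₂ := Nat.succ_descFactorial_succ n k
  rw [Nat.descFactorial_succ] at h₂
  rw [h₁, Nat.descFactorial_eq_factorial_mul_choose (n + 1 - k) k, ← h₂]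
  ring

theorem hypergeometric_coeff (n k : ℕ) (h : 2 * k ≤ n + 1) :
    poch (1 - 2 * ((n + 1 : ℕ) : ℝ) / 3) k * poch (-((n + 1 : ℕ) : ℝ) / 2) k *
        poch ((1 - ((n + 1 : ℕ) : ℝ)) / 2) k * 4 ^ k /
      (k.factorial * poch (-(2 * ((n + 1 : ℕ) : ℝ)) / 3) k * poch (1 - ((n + 1 : ℕ) : ℝ)) k) =
      1 / 2 * (-1) ^ k * ((n + 1 - k).choose k + (n - k).choose k) := by
  have hkn : k ≤ n := by omega
  have hn0 : (n : ℝ) + 1 ≠ 0 := by positivity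
  have hlt : (0 : ℝ) < n + 1 - k := by
    have : (k : ℝ) ≤ n := by exact_mod_cast hkn
    linarith
  have hden : poch (-(2 * ((n + 1 : ℕ) : ℝ)) / 3) k ≠ 0 := by
    refine poch_ne_zero fun i hi => ne_of_lt ?_
    have h₁ : (i : ℝ) + 1 ≤ k := by exact_mod_cast hi
    have h₂ : 2 * (k : ℝ) ≤ n + 1 := by exact_mod_cast h
    push_cast
    linarith
  have hdesc : (n.descFactorial k : ℝ) ≠ 0 := by
    exact_mod_cast (Nat.descFactorial_pos.2 hkn).ne'
  have hfac : (k.factorial : ℝ) ≠ 0 := by exact_mod_cast k.factorial_ne_zero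
  have hshift : poch (1 - 2 * ((n + 1 : ℕ) : ℝ) / 3) k =
      poch (-(2 * ((n + 1 : ℕ) : ℝ)) / 3) k * ((2 * (n + 1) - 3 * k) / (2 * (n + 1))) := by
    have h₁ := poch_succ (-(2 * ((n + 1 : ℕ) : ℝ)) / 3) k
    rw [poch_succ', show -(2 * ((n + 1 : ℕ) : ℝ)) / 3 + 1 = 1 - 2 * ((n + 1 : ℕ) : ℝ) / 3 by ring]
      at h₁
    rw [← mul_div_assoc, eq_div_iff (by positivity)]
    push_cast at h₁ ⊢
    linear_combination -3 * h₁
  have hdup : poch (-((n + 1 : ℕ) : ℝ) / 2) k * poch ((1 - ((n + 1 : ℕ) : ℝ)) / 2) k * 4 ^ k =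
      (n + 1).descFactorial (2 * k) := by
    have h₁ := poch_two_mul (-((n + 1 : ℕ) : ℝ)) k
    rw [poch_neg_natCast, pow_mul, neg_one_sq, one_pow, one_mul,
      show -((n + 1 : ℕ) : ℝ) + 1 = 1 - ((n + 1 : ℕ) : ℝ) by ring] at h₁
    linear_combination -h₁
  have hneg : poch (1 - ((n + 1 : ℕ) : ℝ)) k = (-1) ^ k * n.descFactorial k := by
    rw [← poch_neg_natCast]
    congr 1
    push_cast
    ring
  have hD : ((n + 1).descFactorial (2 * k) : ℝ) * (n + 1 - k) =
      (n + 1) * n.descFactorial k * k.factorial * (n + 1 - k).choose k := by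
    have h₁ := congrArg (Nat.cast (R := ℝ)) (descFactorial_two_mul_mul n k)
    push_cast [Nat.cast_sub (show k ≤ n + 1 by omega)] at h₁
    exact h₁
  have hC : ((n - k).choose k : ℝ) * (n + 1 - k) =
      (n + 1 - k).choose k * (n + 1 - 2 * k) := by
    have h₁ := Nat.choose_mul_succ_eq (n - k) k
    rw [show n - k + 1 = n + 1 - k by omega, show n + 1 - k - k = n + 1 - 2 * k by omega] at h₁
    have h₂ := congrArg (Nat.cast (R := ℝ)) h₁
    push_cast [Nat.cast_sub (show k ≤ n + 1 by omega), Nat.cast_sub h] at h₂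
    exact h₂
  have hsign : ((-1 : ℝ) ^ k) * (-1) ^ k = 1 := by
    rw [← mul_pow]
    simp
  have hsum : 1 / 2 * (((n + 1 - k).choose k : ℝ) + (n - k).choose k) =
      (2 * (n + 1) - 3 * k) / (2 * (n + 1)) * (n + 1).descFactorial (2 * k) /
        (k.factorial * n.descFactorial k) := by
    rw [div_mul_eq_mul_div _ (2 * ((n : ℝ) + 1)), div_div,
      eq_div_iff (by simp [hn0, hfac, hdesc])]
    refine mul_right_cancel₀ hlt.ne' ?_
    linear_combination (n + 1) * k.factorial * n.descFactorial k * hC -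
      (2 * (n + 1) - 3 * k) * hD
  rw [mul_right_comm _ ((-1 : ℝ) ^ k), hsum, mul_assoc (poch _ k), mul_assoc (poch _ k), hdup,
    hshift, hneg]
  generalize poch (-(2 * ((n + 1 : ℕ) : ℝ)) / 3) k = p at hden ⊢
  generalize (-1 : ℝ) ^ k = s at hsign ⊢
  have hs : s ≠ 0 := left_ne_zero_of_mul_eq_one hsign
  field_simp
  linear_combination -(2 * (n + 1) - 3 * k) * (n + 1).descFactorial (2 * k) * hsign

/-- Lemma A4: a terminating ₅F₄ summation. -/
theorem lemA4 (n : ℕ) (hn : 0 < n) (A B : ℝ) (hB : poch (1 + B) n ≠ 0)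
    (hAB : 2 * A + B ≠ 0) :
    ∑ k ∈ Finset.range (n / 2 + 1),
      (poch (1 - 2 * (n : ℝ) / 3) k * poch (-(n : ℝ) / 2) k * poch ((1 - (n : ℝ)) / 2) k *
          poch (-A) k * poch (A + B) k) /
        ((Nat.factorial k : ℝ) * poch (-(2 * (n : ℝ)) / 3) k * poch (1 - (n : ℝ)) k *
          poch ((1 + B) / 2) k * poch (1 + B / 2) k) =
      (1 / 2) * ((A - B - 2 * n) / (2 * A + B)) * (poch (-A) n / poch (1 + B) n) +
        (1 / 2) * ((A + 2 * B + 2 * n) / (2 * A + B)) * (poch (A + B) n / poch (1 + B) n) := by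
  obtain ⟨n, rfl⟩ : ∃ m, n = m + 1 := ⟨n - 1, by omega⟩
  have hterm : ∀ k ∈ range ((n + 1) / 2 + 1),
      (poch (1 - 2 * ((n + 1 : ℕ) : ℝ) / 3) k * poch (-((n + 1 : ℕ) : ℝ) / 2) k *
          poch ((1 - ((n + 1 : ℕ) : ℝ)) / 2) k * poch (-A) k * poch (A + B) k) /
        ((Nat.factorial k : ℝ) * poch (-(2 * ((n + 1 : ℕ) : ℝ)) / 3) k *
          poch (1 - ((n + 1 : ℕ) : ℝ)) k * poch ((1 + B) / 2) k * poch (1 + B / 2) k) =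
      (lucasTerm (-A) (A + B) (n + 1) k + (1 + B + n) * lucasTerm (-A) (A + B) n k) /
        (2 * poch (1 + B) (n + 1)) := by
    intro k hk
    have hk : 2 * k ≤ n + 1 := by
      rw [mem_range] at hk
      omega
    have hsplit : poch (1 + B) (n + 1) =
        poch (1 + B) (2 * k) * poch (1 + B + 2 * k) (n + 1 - 2 * k) := by
      rw [← Nat.add_sub_of_le hk, poch_add, Nat.add_sub_cancel_left]
      push_cast
      rfl
    have hdup := poch_two_mul (1 + B) k
    rw [show (1 + B + 1) / 2 = 1 + B / 2 by ring] at hdup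
    have hrest : poch (1 + B + 2 * k) (n + 1 - 2 * k) ≠ 0 := right_ne_zero_of_mul (hsplit ▸ hB)
    have hhead : poch (1 + B) (2 * k) ≠ 0 := left_ne_zero_of_mul (hsplit ▸ hB)
    have hsum := choose_mul_poch_sub (1 + B) n k hk
    have hcoeff := hypergeometric_coeff n k hk
    have hlucas : lucasTerm (-A) (A + B) (n + 1) k + (1 + B + n) * lucasTerm (-A) (A + B) n k =
        (-1) ^ k * ((n + 1 - k).choose k + (n - k).choose k) * poch (-A) k * poch (A + B) k *
          poch (1 + B + 2 * k) (n + 1 - 2 * k) := by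
      simp only [lucasTerm, show 1 + -A + (A + B) = 1 + B by ring]
      linear_combination -(-1) ^ k * poch (-A) k * poch (A + B) k * hsum
    calc
      _ = poch (1 - 2 * ((n + 1 : ℕ) : ℝ) / 3) k * poch (-((n + 1 : ℕ) : ℝ) / 2) k *
            poch ((1 - ((n + 1 : ℕ) : ℝ)) / 2) k * 4 ^ k /
          (k.factorial * poch (-(2 * ((n + 1 : ℕ) : ℝ)) / 3) k *
            poch (1 - ((n + 1 : ℕ) : ℝ)) k) *
          (poch (-A) k * poch (A + B) k / poch (1 + B) (2 * k)) := by
        rw [hdup, div_mul_div_comm, ← mul_div_mul_left _ _ (show (4 : ℝ) ^ k ≠ 0 by positivity)]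
        congr 1 <;> ring
      _ = _ := by
        rw [hcoeff, hlucas, hsplit]
        field_simp
  rw [Finset.sum_congr rfl hterm, ← Finset.sum_div, Finset.sum_add_distrib, ← Finset.mul_sum]
  have h₁ := sub_mul_sum_lucasTerm (n + 1) (-A) (A + B) ((n + 1) / 2 + 1) (by omega)
  have h₀ := sub_mul_sum_lucasTerm n (-A) (A + B) ((n + 1) / 2 + 1) (by omega)
  rw [poch_succ _ (n + 1), poch_succ _ (n + 1)] at h₁
  have hsum : ∑ k ∈ range ((n + 1) / 2 + 1), lucasTerm (-A) (A + B) (n + 1) k +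
      (1 + B + n) * ∑ k ∈ range ((n + 1) / 2 + 1), lucasTerm (-A) (A + B) n k =
        ((A - B - 2 * (n + 1)) * poch (-A) (n + 1) +
          (A + 2 * B + 2 * (n + 1)) * poch (A + B) (n + 1)) / (2 * A + B) := by
    rw [eq_div_iff hAB]
    push_cast at h₁
    linear_combination h₁ + (1 + B + n) * h₀
  rw [hsum]
  push_cast
  ring
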